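/- arXiv:2110.15364 — 3 statements merged into one kernel-verified Lean document; each statement's English description precedes it below -/
import Mathlib

section
/- Let A be an n×n real symmetric matrix of rank r, and let D₁, …, Dₙ be a normal principal minor sequence of A. Then q(A) = δ_{−1, sgn(D₁)} + Σ_{i=1}^{r−1} δ_{−1, sgn(D_i D_{i+1})} + Σ_{i=1}^{r−1} δ_{0, D_i}, where q(A) is the negative index of inertia and δ is the Kronecker delta. -/
open Matrix

/-- The negative index of inertia of a real symmetric matrix. -/
noncomputable def negInertia {n : ℕ} (M : Matrix (Fin n) (Fin n) ℝ) : ℕ :=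
  if h : M.IsHermitian then (Finset.univ.filter fun i => h.eigenvalues i < 0).card
  else 0

/-- The principal minor of `A` with rows and columns indexed by the finset `s`. -/
noncomputable def principalMinor {n : ℕ} (A : Matrix (Fin n) (Fin n) ℝ)
    (s : Finset (Fin n)) : ℝ :=
  Matrix.det (A.submatrix
    (fun k : Fin s.card => ((s.orderIsoOfFin rfl k : Fin n)))
    (fun k : Fin s.card => ((s.orderIsoOfFin rfl k : Fin n))))

lemma QuadraticForm.sigPos_comp_le {M N : Type*} [AddCommGroup M] [Module ℝ M]
    [FiniteDimensional ℝ M] [AddCommGroup N] [Module ℝ N] [FiniteDimensional ℝ N]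
    (Q : QuadraticForm ℝ N) {f : M →ₗ[ℝ] N} (hf : Function.Injective f) :
    sigPos (Q.comp f) ≤ sigPos Q := by
  obtain ⟨V, hV, hpos⟩ := exists_finrank_eq_sigPos_and_posDef (Q.comp f)
  rw [← hV, (Submodule.equivMapOfInjective f hf V).finrank_eq]
  refine le_sigPos_of_posDef Q ?_
  rintro ⟨_, x, hx, rfl⟩ hne
  exact hpos ⟨x, hx⟩ fun h => hne <| by simp_all

lemma QuadraticForm.sigPos_add_finrank_le_sigPos_comp_add_finrank {M N : Type*}
    [AddCommGroup M] [Module ℝ M] [FiniteDimensional ℝ M] [AddCommGroup N] [Module ℝ N]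
    [FiniteDimensional ℝ N] (Q : QuadraticForm ℝ N) {f : M →ₗ[ℝ] N}
    (hf : Function.Injective f) :
    sigPos Q + Module.finrank ℝ M ≤ sigPos (Q.comp f) + Module.finrank ℝ N := by
  obtain ⟨V, hV, hpos⟩ := exists_finrank_eq_sigPos_and_posDef Q
  have hcomap : ((Q.comp f).restrict (V.comap f)).PosDef := by
    rintro ⟨x, hx⟩ hne
    refine hpos ⟨f x, hx⟩ fun h => hne ?_
    simpa [map_eq_zero_iff f hf] using h
  have h₁ := le_sigPos_of_posDef _ hcomap
  have h₂ : Module.finrank ℝ (V.comap f) = Module.finrank ℝ ↥(LinearMap.range f ⊓ V) := by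
    rw [← Submodule.map_comap_eq]
    exact (Submodule.equivMapOfInjective f hf _).finrank_eq
  have h₃ := Submodule.finrank_sup_add_finrank_inf_eq (LinearMap.range f) V
  have h₄ := (LinearMap.range f ⊔ V).finrank_le
  rw [LinearMap.finrank_range_of_inj hf] at h₃
  omega

namespace Matrix

variable {ι κ : Type*} [Fintype ι] [Fintype κ] [DecidableEq ι] [DecidableEq κ]

lemma toQuadraticForm'_apply_dotProduct (A : Matrix ι ι ℝ) (x : ι → ℝ) :
    A.toQuadraticForm' x = x ⬝ᵥ A *ᵥ x :=
  toLinearMap₂'_apply' A x x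

lemma toQuadraticForm'_neg (A : Matrix ι ι ℝ) :
    (-A).toQuadraticForm' = -A.toQuadraticForm' := by
  ext x
  simp [toQuadraticForm'_apply_dotProduct, neg_mulVec]

lemma toQuadraticForm'_conj (A : Matrix ι ι ℝ) (P : Matrix ι κ ℝ) :
    (Pᵀ * A * P).toQuadraticForm' = A.toQuadraticForm'.comp P.mulVecLin := by
  ext x
  simp only [toQuadraticForm'_apply_dotProduct, QuadraticMap.comp_apply, mulVecLin_apply]
  rw [Matrix.mul_assoc, ← mulVec_mulVec, ← mulVec_mulVec, dotProduct_mulVec, vecMul_transpose]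

lemma exists_injective_toQuadraticForm'_submatrix (A : Matrix ι ι ℝ) {g : κ → ι}
    (hg : Function.Injective g) :
    ∃ f : (κ → ℝ) →ₗ[ℝ] (ι → ℝ), Function.Injective f ∧
      (A.submatrix g g).toQuadraticForm' = A.toQuadraticForm'.comp f := by
  set P : Matrix ι κ ℝ := (1 : Matrix ι ι ℝ).submatrix id g
  have hP : Pᵀ * P = 1 := by
    ext i j
    simp [P, mul_apply, one_apply, hg.eq_iff]
  refine ⟨P.mulVecLin, fun x y h => ?_, ?_⟩
  · simpa [mulVec_mulVec, hP] using congrArg (Pᵀ *ᵥ ·) h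
  · rw [← toQuadraticForm'_conj]
    congr 1
    ext i j
    simp [P, mul_apply, one_apply]

lemma IsHermitian.equivalent_weightedSumSquares_eigenvalues {A : Matrix ι ι ℝ}
    (hA : A.IsHermitian) :
    A.toQuadraticForm'.Equivalent (QuadraticMap.weightedSumSquares ℝ hA.eigenvalues) := by
  set U : Matrix ι ι ℝ := ↑hA.eigenvectorUnitary
  have hU : Uᵀ * U = 1 := by
    simpa [U, star_eq_conjTranspose, conjTranspose_eq_transpose_of_trivial] using
      Unitary.coe_star_mul_self hA.eigenvectorUnitary
  have hU' : U * Uᵀ = 1 := mul_eq_one_comm.mp hU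
  have hdiag : Uᵀ * A * U = diagonal hA.eigenvalues := by
    have := hA.conjStarAlgAut_star_eigenvectorUnitary
    rw [Unitary.conjStarAlgAut_star_apply] at this
    simpa [U, star_eq_conjTranspose, conjTranspose_eq_transpose_of_trivial] using! this
  let e : (ι → ℝ) ≃ₗ[ℝ] (ι → ℝ) := LinearEquiv.ofLinearMap U.mulVecLin Uᵀ.mulVecLin
    (by rw [← mulVecLin_mul, hU', mulVecLin_one]) (by rw [← mulVecLin_mul, hU, mulVecLin_one])
  refine QuadraticMap.Equivalent.symm ⟨⟨e, fun x => ?_⟩⟩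
  have h := congrArg (fun B => B.toQuadraticForm' x) hdiag
  simp only [toQuadraticForm'_conj, QuadraticMap.comp_apply] at h
  refine h.trans ?_
  rw [toQuadraticForm'_apply_dotProduct, QuadraticMap.weightedSumSquares_apply]
  simp only [dotProduct, mulVec_diagonal, smul_eq_mul]
  exact Finset.sum_congr rfl fun i _ => by ring

lemma IsHermitian.sigPos_eq_card {A : Matrix ι ι ℝ} (hA : A.IsHermitian) :
    sigPos A.toQuadraticForm' = (Finset.univ.filter fun i => 0 < hA.eigenvalues i).card := by
  rw [QuadraticForm.sigPos_of_equiv_weightedSumSquares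
    hA.equivalent_weightedSumSquares_eigenvalues, ← Set.ncard_coe_finset]
  simp

lemma IsHermitian.sigNeg_eq_card {A : Matrix ι ι ℝ} (hA : A.IsHermitian) :
    sigNeg A.toQuadraticForm' = (Finset.univ.filter fun i => hA.eigenvalues i < 0).card := by
  rw [QuadraticForm.sigNeg_of_equiv_weightedSumSquares
    hA.equivalent_weightedSumSquares_eigenvalues, ← Set.ncard_coe_finset]
  simp

lemma IsHermitian.sigPos_add_sigNeg {A : Matrix ι ι ℝ} (hA : A.IsHermitian) :
    sigPos A.toQuadraticForm' + sigNeg A.toQuadraticForm' = A.rank := by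
  rw [hA.sigPos_eq_card, hA.sigNeg_eq_card, hA.rank_eq_card_non_zero_eigs, Fintype.card_subtype,
    ← Finset.card_union_of_disjoint]
  · congr 1
    ext i
    simp [lt_or_lt_iff_ne, eq_comm]
  · exact Finset.disjoint_filter.mpr fun i _ h => h.not_gt

lemma IsHermitian.neg_one_pow_sigNeg_mul_det_pos {A : Matrix ι ι ℝ} (hA : A.IsHermitian)
    (hdet : A.det ≠ 0) : 0 < (-1) ^ sigNeg A.toQuadraticForm' * A.det := by
  have hne : ∀ i, hA.eigenvalues i ≠ 0 := fun i hi => hdet <| by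
    rw [hA.det_eq_prod_eigenvalues]
    exact Finset.prod_eq_zero (Finset.mem_univ i) (by simp [hi])
  rw [hA.sigNeg_eq_card, ← Finset.prod_const, Finset.prod_filter, hA.det_eq_prod_eigenvalues,
    ← Finset.prod_mul_distrib]
  refine Finset.prod_pos fun i _ => ?_
  rcases (hne i).lt_or_gt with h | h
  · simp [h]
  · simpa [h.not_gt] using h

lemma rank_eq_card_of_det_ne_zero {A : Matrix ι ι ℝ} (h : A.det ≠ 0) :
    A.rank = Fintype.card ι :=
  rank_of_isUnit A ((isUnit_iff_isUnit_det A).mpr h.isUnit)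

lemma rank_lt_card_of_det_eq_zero {A : Matrix ι ι ℝ} (h : A.det = 0) :
    A.rank < Fintype.card ι := by
  obtain ⟨v, hv, hAv⟩ := exists_mulVec_eq_zero_iff.mpr h
  have h₁ := A.mulVecLin.finrank_range_add_finrank_ker
  have h₂ : 0 < Module.finrank ℝ (LinearMap.ker A.mulVecLin) :=
    Module.finrank_pos_iff_exists_ne_zero.mpr ⟨⟨v, hAv⟩, fun h => hv (congrArg Subtype.val h)⟩
  rw [Module.finrank_fintype_fun_eq_card] at h₁
  change Module.finrank ℝ _ < _
  omega

lemma sigPos_submatrix_le (A : Matrix ι ι ℝ) {g : κ → ι} (hg : Function.Injective g) :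
    sigPos (A.submatrix g g).toQuadraticForm' ≤ sigPos A.toQuadraticForm' := by
  obtain ⟨f, hf, h⟩ := A.exists_injective_toQuadraticForm'_submatrix hg
  exact h ▸ QuadraticForm.sigPos_comp_le _ hf

lemma sigPos_add_card_le_sigPos_submatrix_add_card (A : Matrix ι ι ℝ) {g : κ → ι}
    (hg : Function.Injective g) :
    sigPos A.toQuadraticForm' + Fintype.card κ ≤
      sigPos (A.submatrix g g).toQuadraticForm' + Fintype.card ι := by
  obtain ⟨f, hf, h⟩ := A.exists_injective_toQuadraticForm'_submatrix hg
  simpa [h] using QuadraticForm.sigPos_add_finrank_le_sigPos_comp_add_finrank _ hf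

lemma sigNeg_submatrix_le (A : Matrix ι ι ℝ) {g : κ → ι} (hg : Function.Injective g) :
    sigNeg (A.submatrix g g).toQuadraticForm' ≤ sigNeg A.toQuadraticForm' := by
  simpa only [submatrix_neg, Pi.neg_apply, toQuadraticForm'_neg, sigPos_neg] using
    (-A).sigPos_submatrix_le hg

lemma sigNeg_add_card_le_sigNeg_submatrix_add_card (A : Matrix ι ι ℝ) {g : κ → ι}
    (hg : Function.Injective g) :
    sigNeg A.toQuadraticForm' + Fintype.card κ ≤
      sigNeg (A.submatrix g g).toQuadraticForm' + Fintype.card ι := by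
  simpa only [submatrix_neg, Pi.neg_apply, toQuadraticForm'_neg, sigPos_neg] using
    (-A).sigPos_add_card_le_sigPos_submatrix_add_card hg

end Matrix

lemma principalMinor_eq_det_submatrix_val {n : ℕ} (A : Matrix (Fin n) (Fin n) ℝ)
    (s : Finset (Fin n)) :
    principalMinor A s = (A.submatrix ((↑) : s → Fin n) ((↑) : s → Fin n)).det :=
  det_submatrix_equiv_self (s.orderIsoOfFin rfl).toEquiv
    (A.submatrix ((↑) : s → Fin n) ((↑) : s → Fin n))

lemma mul_neg_iff_of_neg_one_pow_mul_pos {a b : ℝ} {k l : ℕ} (ha : 0 < (-1) ^ k * a)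
    (hb : 0 < (-1) ^ l * b) : a * b < 0 ↔ Odd (k + l) := by
  rcases Nat.even_or_odd k with hk | hk <;> rcases Nat.even_or_odd l with hl | hl <;>
    simp [hk.neg_one_pow] at ha <;> simp [hl.neg_one_pow] at hb
  · simp [Nat.not_odd_iff_even.mpr (hk.add hl), (mul_pos ha hb).le]
  · simp [hk.add_odd hl, mul_neg_of_pos_of_neg ha hb]
  · simp [hk.add_even hl, mul_neg_of_neg_of_pos ha hb]
  · simp [Nat.not_odd_iff_even.mpr (hk.add_odd hl), (mul_pos_of_neg_of_neg ha hb).le]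

/-- Here `p i` and `q i` play the role of the inertia indices of the leading block of order `i`,
whose determinant is `D i`. -/
lemma eq_sum_sign_changes_add_sum_zeros {p q : ℕ → ℕ} {D : ℕ → ℝ} {r : ℕ}
    (hp : ∀ i < r, p i ≤ p (i + 1) ∧ p (i + 1) ≤ p i + 1)
    (hq : ∀ i < r, q i ≤ q (i + 1) ∧ q (i + 1) ≤ q i + 1)
    (hne : ∀ i ≤ r, D i ≠ 0 → p i + q i = i) (hzero : ∀ i ≤ r, D i = 0 → p i + q i < i)
    (hsign : ∀ i ≤ r, D i ≠ 0 → 0 < (-1) ^ q i * D i)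
    (hD : ∀ i < r, ¬(D i = 0 ∧ D (i + 1) = 0)) (k : ℕ) (hk : k ≤ r) (hDk : D k ≠ 0) :
    q k = ∑ i ∈ Finset.range k, (if D i * D (i + 1) < 0 then 1 else 0)
      + ∑ i ∈ Finset.range k, (if D i = 0 then 1 else 0) := by
  induction k using Nat.strong_induction_on with
  | _ k ih =>
    rcases k with _ | k
    · have := hne 0 hk hDk
      simp
      omega
    by_cases hDk' : D k = 0
    · rcases k with _ | j
      · exact absurd (hzero 0 (by omega) hDk') (by omega)
      have hDj : D j ≠ 0 := fun h => hD j (by omega) ⟨h, hDk'⟩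
      have := ih j (by omega) (by omega) hDj
      have := hp j (by omega)
      have := hq j (by omega)
      have := hp (j + 1) (by omega)
      have := hq (j + 1) (by omega)
      have := hne j (by omega) hDj
      have := hzero (j + 1) (by omega) hDk'
      have := hne (j + 1 + 1) hk hDk
      simp only [Finset.sum_range_succ, hDk', hDj, mul_zero, zero_mul, lt_irrefl, if_true,
        if_false]
      omega
    · have h₁ := ih k (by omega) (by omega) hDk'
      have h₂ := hq k (by omega)
      have h₃ := mul_neg_iff_of_neg_one_pow_mul_pos (hsign k (by omega) hDk') (hsign _ hk hDk)
      simp only [Finset.sum_range_succ, hDk', if_false, h₃]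
      split_ifs with h <;> rw [Nat.odd_iff] at h <;> omega

theorem stmt6 {n : ℕ} (A : Matrix (Fin n) (Fin n) ℝ) (hA : A.IsSymm)
    (I : ℕ → Finset (Fin n))
    (hcard : ∀ i, i ≤ n → (I i).card = i)
    (hchain : ∀ i, i < n → I i ⊂ I (i + 1))
    (D : ℕ → ℝ) (hD : ∀ i, D i = principalMinor A (I i))
    -- normality of the principal minor sequence:
    (hnorm1 : D A.rank ≠ 0)
    (hnorm2 : ∀ i, 1 ≤ i → i + 1 ≤ A.rank → ¬(D i = 0 ∧ D (i + 1) = 0)) :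
    negInertia A =
      (if D 1 < 0 then 1 else 0)
        + ∑ i ∈ Finset.Icc 1 (A.rank - 1), (if D i * D (i + 1) < 0 then 1 else 0)
        + ∑ i ∈ Finset.Icc 1 (A.rank - 1), (if D i = 0 then 1 else 0) := by
  have hH : A.IsHermitian := (conjTranspose_eq_transpose_of_trivial A).trans hA
  set r := A.rank
  have hrn : r ≤ n := by simpa using A.rank_le_card_width
  let B (i : ℕ) : Matrix (I i) (I i) ℝ := A.submatrix (↑) (↑)
  have hB (i : ℕ) : (B i).IsHermitian := hH.submatrix _
  have hDB (i : ℕ) : D i = (B i).det := (hD i).trans (principalMinor_eq_det_submatrix_val A (I i))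
  let p (i : ℕ) : ℕ := sigPos (B i).toQuadraticForm'
  let q (i : ℕ) : ℕ := sigNeg (B i).toQuadraticForm'
  have hpq (i : ℕ) : p i + q i = (B i).rank := (hB i).sigPos_add_sigNeg
  have hincl (i : ℕ) (hi : i < r) : ∃ g : I i → I (i + 1), Function.Injective g ∧
      B i = (B (i + 1)).submatrix g g :=
    ⟨_, Set.inclusion_injective (hchain i (by omega)).subset, rfl⟩
  have hp (i : ℕ) (hi : i < r) : p i ≤ p (i + 1) ∧ p (i + 1) ≤ p i + 1 := by
    obtain ⟨g, hg, h⟩ := hincl i hi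
    have h₁ := (B (i + 1)).sigPos_submatrix_le hg
    have h₂ := (B (i + 1)).sigPos_add_card_le_sigPos_submatrix_add_card hg
    rw [Fintype.card_coe, Fintype.card_coe, hcard i (by omega), hcard _ (by omega), ← h] at h₂
    rw [← h] at h₁
    change p _ ≤ p _ at h₁
    change p _ + _ ≤ p _ + _ at h₂
    omega
  have hq (i : ℕ) (hi : i < r) : q i ≤ q (i + 1) ∧ q (i + 1) ≤ q i + 1 := by
    obtain ⟨g, hg, h⟩ := hincl i hi
    have h₁ := (B (i + 1)).sigNeg_submatrix_le hg
    have h₂ := (B (i + 1)).sigNeg_add_card_le_sigNeg_submatrix_add_card hg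
    rw [Fintype.card_coe, Fintype.card_coe, hcard i (by omega), hcard _ (by omega), ← h] at h₂
    rw [← h] at h₁
    change q _ ≤ q _ at h₁
    change q _ + _ ≤ q _ + _ at h₂
    omega
  have hne (i : ℕ) (hi : i ≤ r) (h : D i ≠ 0) : p i + q i = i := by
    rw [hpq, rank_eq_card_of_det_ne_zero (hDB i ▸ h), Fintype.card_coe, hcard i (by omega)]
  have hzero (i : ℕ) (hi : i ≤ r) (h : D i = 0) : p i + q i < i := by
    have := rank_lt_card_of_det_eq_zero ((hDB i).symm.trans h)
    rwa [← hpq, Fintype.card_coe, hcard i (by omega)] at this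
  have hsign (i : ℕ) (h : D i ≠ 0) : 0 < (-1) ^ q i * D i := by
    rw [hDB] at h ⊢
    exact (hB i).neg_one_pow_sigNeg_mul_det_pos h
  have hpA (i : ℕ) : p i ≤ sigPos A.toQuadraticForm' :=
    A.sigPos_submatrix_le Subtype.val_injective
  have hqA (i : ℕ) : q i ≤ sigNeg A.toQuadraticForm' :=
    A.sigNeg_submatrix_le Subtype.val_injective
  have hpqA : sigPos A.toQuadraticForm' + sigNeg A.toQuadraticForm' = r := hH.sigPos_add_sigNeg
  have hD0 : D 0 ≠ 0 := fun h => Nat.not_lt_zero _ (hzero 0 (Nat.zero_le _) h)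
  have hnormal (i : ℕ) (hi : i < r) : ¬(D i = 0 ∧ D (i + 1) = 0) := by
    rcases Nat.eq_zero_or_pos i with rfl | h
    · exact fun h => hD0 h.1
    · exact hnorm2 i h hi
  have hqr : negInertia A = q r := by
    have h₁ : negInertia A = sigNeg A.toQuadraticForm' := by
      rw [negInertia, dif_pos hH, hH.sigNeg_eq_card]
    have := hpA r
    have := hqA r
    have := hne r le_rfl hnorm1
    omega
  rw [hqr, eq_sum_sign_changes_add_sum_zeros hp hq hne hzero (fun i _ => hsign i) hnormal r le_rfl
    hnorm1]
  rcases Nat.eq_zero_or_pos r with hr | hr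
  · have hD1 : ¬D 1 < 0 := fun h => by
      have h₁ := hsign 1 h.ne
      have h₂ : q 1 = 0 := by have := hqA 1; omega
      rw [h₂, pow_zero, one_mul] at h₁
      exact h.not_gt h₁
    simp [hr, hD1]
  · have hq0 : q 0 = 0 := by have := hne 0 hr.le hD0; omega
    have hD0pos : 0 < D 0 := by simpa [hq0] using hsign 0 hD0
    have hIcc : Finset.Icc 1 (r - 1) = Finset.Ico 1 r := by
      ext i
      simp only [Finset.mem_Icc, Finset.mem_Ico]
      omega
    rw [hIcc, Finset.range_eq_Ico, Finset.sum_eq_sum_Ico_succ_bot hr,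
      Finset.sum_eq_sum_Ico_succ_bot hr]
    simp [hD0, mul_neg_iff, hD0pos, hD0pos.not_gt]
end

section
/- Let (f, g) be a pair of non-constant real polynomials with Sturm chain f₀, …, f_m and Sturm matrix S_{f,g}(x). If a ∈ ℝ is not a common root of f and g, then the negative index of inertia q(S_{f,g}(a)) equals V_{f,g}(a), the number of sign variations in the sequence f₀(a), f₁(a), …, f_m(a) (zeros being deleted before counting variations). -/
open Polynomial Matrix

/-- The Sturm matrix: the `m × m` symmetric tridiagonal matrix with diagonal
entries `d 1 x, …, d m x` and off-diagonal entries `1`. -/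
noncomputable def sturmMatrix (m : ℕ) (d : ℕ → Polynomial ℝ) (x : ℝ) :
    Matrix (Fin m) (Fin m) ℝ :=
  Matrix.of fun i j =>
    if (i : ℕ) = (j : ℕ) then (d ((i : ℕ) + 1)).eval x
    else if (i : ℕ) + 1 = (j : ℕ) ∨ (j : ℕ) + 1 = (i : ℕ) then 1 else 0

/-- Number of sign changes in a list of nonzero reals. -/
noncomputable def signChanges : List ℝ → ℕ
  | a :: b :: t => (if a * b < 0 then 1 else 0) + signChanges (b :: t)
  | _ => 0

/-- Number of sign variations of a real sequence: zeros are deleted first. -/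
noncomputable def signVar (l : List ℝ) : ℕ :=
  signChanges (l.filter fun x => @decide (x ≠ 0) (Classical.propDecidable _))

/-- `M` admits an orthogonal family of `n` linearly independent vectors, exactly `k` of which are
negative. -/
def HasOrthogonalFamily {n : ℕ} (M : Matrix (Fin n) (Fin n) ℝ) (k : ℕ) : Prop :=
  ∃ p : Fin n → Fin n → ℝ, LinearIndependent ℝ p ∧
    (∀ i j, i ≠ j → p i ⬝ᵥ M *ᵥ p j = 0) ∧
    (Finset.univ.filter fun i => p i ⬝ᵥ M *ᵥ p i < 0).card = k

theorem Matrix.IsSymm.dotProduct_mulVec_comm {n : ℕ} {M : Matrix (Fin n) (Fin n) ℝ}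
    (hM : M.IsSymm) (x y : Fin n → ℝ) : x ⬝ᵥ M *ᵥ y = y ⬝ᵥ M *ᵥ x := by
  rw [dotProduct_mulVec, ← mulVec_transpose, hM.eq, dotProduct_comm]

/-- Sylvester's law of inertia, for the negative index. -/
theorem HasOrthogonalFamily.sigNeg_eq {n : ℕ} {M : Matrix (Fin n) (Fin n) ℝ} {k : ℕ}
    (h : HasOrthogonalFamily M k) : sigNeg M.toQuadraticForm' = k := by
  obtain ⟨p, hp, ho, rfl⟩ := h
  have hQ : ∀ x, M.toQuadraticForm' x = x ⬝ᵥ M *ᵥ x := fun x => by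
    simp [Matrix.toQuadraticForm', Matrix.toLinearMap₂'_apply']
  let b := basisOfLinearIndependentOfCardEqFinrank' p hp (by simp)
  have hb : ∀ i, b i = p i := fun i => by simp [b]
  have hortho : (QuadraticMap.associated (R := ℝ) M.toQuadraticForm').IsOrthoᵢ b := by
    intro i j hij
    have h1 := ho i j hij
    have h2 := ho j i hij.symm
    simp [Function.onFun, QuadraticMap.associated_apply, hQ, hb, mulVec_add,
      h1, h2]
  have e : M.toQuadraticForm'.Equivalent (M.toQuadraticForm'.basisRepr b) :=
    ⟨M.toQuadraticForm'.isometryEquivBasisRepr b⟩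
  rw [QuadraticMap.basisRepr_eq_of_iIsOrtho _ _ hortho] at e
  rw [QuadraticForm.sigNeg_of_equiv_weightedSumSquares e, ← Set.ncard_coe_finset]
  congr 1
  ext i
  simp [hQ, hb]

theorem Matrix.IsHermitian.hasOrthogonalFamily {n : ℕ} {M : Matrix (Fin n) (Fin n) ℝ}
    (h : M.IsHermitian) :
    HasOrthogonalFamily M (Finset.univ.filter fun i => h.eigenvalues i < 0).card := by
  have key : ∀ i j, (h.eigenvectorBasis i).ofLp ⬝ᵥ (h.eigenvectorBasis j).ofLp
      = if i = j then 1 else 0 := fun i j => by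
    have := orthonormal_iff_ite.1 h.eigenvectorBasis.orthonormal j i
    rw [EuclideanSpace.inner_eq_star_dotProduct] at this
    simpa [eq_comm] using this
  refine ⟨fun i => (h.eigenvectorBasis i).ofLp, ?_, ?_, ?_⟩
  · exact h.eigenvectorBasis.toBasis.linearIndependent.map'
      (WithLp.linearEquiv 2 ℝ (Fin n → ℝ)).toLinearMap (LinearEquiv.ker _)
  · intro i j hij
    simp [h.mulVec_eigenvectorBasis, key, hij]
  · simp [h.mulVec_eigenvectorBasis, key]

theorem HasOrthogonalFamily.negInertia_eq {n : ℕ} {M : Matrix (Fin n) (Fin n) ℝ} (hM : M.IsSymm)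
    {k : ℕ} (h : HasOrthogonalFamily M k) : negInertia M = k := by
  have hH : M.IsHermitian := by
    rw [Matrix.IsHermitian, Matrix.conjTranspose_eq_transpose_of_trivial, hM.eq]
  rw [negInertia, dif_pos hH, ← hH.hasOrthogonalFamily.sigNeg_eq, h.sigNeg_eq]

theorem notMem_span_range_of_apply_ne_zero {ι V : Type*} [AddCommGroup V] [Module ℝ V]
    {v : ι → V} {x : V} (φ : V →ₗ[ℝ] ℝ) (hv : ∀ i, φ (v i) = 0) (hx : φ x ≠ 0) :
    x ∉ Submodule.span ℝ (Set.range v) := fun h => hx <| by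
  have : Submodule.span ℝ (Set.range v) ≤ LinearMap.ker φ :=
    Submodule.span_le.2 (by rintro _ ⟨i, rfl⟩; exact hv i)
  exact this h

theorem LinearIndependent.vecCons_zero {ι : Type*} {n : ℕ} {p : ι → Fin n → ℝ}
    (hp : LinearIndependent ℝ p) :
    LinearIndependent ℝ fun i => (vecCons 0 (p i) : Fin (n + 1) → ℝ) := by
  refine LinearIndependent.of_comp (LinearMap.funLeft ℝ ℝ Fin.succ) ?_
  convert hp using 1
  ext i j
  simp [LinearMap.funLeft]

theorem vecCons_zero_dotProduct_mulVec {n : ℕ} (M : Matrix (Fin (n + 1)) (Fin (n + 1)) ℝ)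
    (x y : Fin n → ℝ) :
    vecCons 0 x ⬝ᵥ M *ᵥ vecCons 0 y = x ⬝ᵥ M.submatrix Fin.succ Fin.succ *ᵥ y := by
  simp [mulVec, dotProduct, Fin.sum_univ_succ]

/-- Extending an orthogonal family of the trailing principal submatrix by one vector. -/
theorem HasOrthogonalFamily.succ {n k : ℕ} {M : Matrix (Fin (n + 1)) (Fin (n + 1)) ℝ}
    (hM : M.IsSymm) (h : HasOrthogonalFamily (M.submatrix Fin.succ Fin.succ) k)
    {b : Fin (n + 1) → ℝ} {r : ℝ} (hb : b 0 ≠ 0) (hMb : M *ᵥ b = vecCons r 0) :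
    HasOrthogonalFamily M ((if r * b 0 < 0 then 1 else 0) + k) := by
  obtain ⟨p, hp, ho, rfl⟩ := h
  have h0 : ∀ i, vecCons 0 (p i) ⬝ᵥ M *ᵥ b = 0 := fun i => by simp [hMb]
  have hbb : b ⬝ᵥ M *ᵥ b = r * b 0 := by
    rw [hMb, dotProduct_cons]; simp [vecHead, mul_comm]
  refine ⟨Fin.cons b fun i => vecCons 0 (p i), ?_, ?_, ?_⟩
  · exact linearIndependent_finCons.2 ⟨hp.vecCons_zero,
      notMem_span_range_of_apply_ne_zero (LinearMap.proj 0) (by simp) hb⟩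
  · intro i j hij
    cases i using Fin.cases <;> cases j using Fin.cases
    · exact absurd rfl hij
    · rw [hM.dotProduct_mulVec_comm]; exact h0 _
    · exact h0 _
    · simp only [Fin.cons_succ, vecCons_zero_dotProduct_mulVec]
      exact ho _ _ fun h => hij (h ▸ rfl)
  · rw [Fin.card_filter_univ_succ]
    simp only [Fin.cons_zero, Fin.cons_succ, vecCons_zero_dotProduct_mulVec, hbb]
    split_ifs <;> simp [add_comm]

/-- Extending an orthogonal family of a trailing principal submatrix by two vectors spanning a
hyperbolic plane. -/
theorem HasOrthogonalFamily.succ_succ {n k : ℕ} {M : Matrix (Fin (n + 2)) (Fin (n + 2)) ℝ}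
    (hM : M.IsSymm)
    (h : HasOrthogonalFamily ((M.submatrix Fin.succ Fin.succ).submatrix Fin.succ Fin.succ) k)
    (hM0 : ∀ i : Fin n, M i.succ.succ 0 = 0)
    {b : Fin (n + 2) → ℝ} {r : ℝ} (hb0 : b 0 = 0) (hb1 : b 1 ≠ 0) (hr : r ≠ 0)
    (hMb : M *ᵥ b = vecCons r 0) :
    HasOrthogonalFamily M (1 + k) := by
  obtain ⟨p, hp, ho, rfl⟩ := h
  set e : Fin (n + 2) → ℝ := Pi.single 0 1 with he
  have h0b : ∀ i, vecCons 0 (vecCons 0 (p i)) ⬝ᵥ M *ᵥ b = 0 := fun i => by simp [hMb]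
  have h0e : ∀ i, vecCons 0 (vecCons 0 (p i)) ⬝ᵥ M *ᵥ e = 0 := fun i => by
    simp [he, dotProduct, Fin.sum_univ_succ, hM0]
  have hbb : b ⬝ᵥ M *ᵥ b = 0 := by
    rw [hMb, dotProduct_cons]; simp [vecHead, hb0]
  have heb : e ⬝ᵥ M *ᵥ b = r := by simp [hMb, he]
  have hbe : b ⬝ᵥ M *ᵥ e = r := by rw [hM.dotProduct_mulVec_comm, heb]
  have hee : e ⬝ᵥ M *ᵥ e = M 0 0 := by simp [he]
  have hcomb : ∀ s t : ℝ, (e + s • b) ⬝ᵥ M *ᵥ (e + t • b) = M 0 0 + (s + t) * r := fun s t => by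
    simp only [mulVec_add, mulVec_smul, add_dotProduct, dotProduct_add, smul_dotProduct,
      dotProduct_smul, smul_eq_mul, hbb, heb, hbe, hee]
    ring
  have hcomb0 : ∀ i (s : ℝ), vecCons 0 (vecCons 0 (p i)) ⬝ᵥ M *ᵥ (e + s • b) = 0 := fun i s => by
    rw [mulVec_add, mulVec_smul, dotProduct_add, dotProduct_smul, h0b, h0e]; simp
  obtain ⟨s, hs⟩ : ∃ s : ℝ, M 0 0 + 2 * s * r = 0 := ⟨-M 0 0 / (2 * r), by field_simp; ring⟩
  have hee0 : e 0 = 1 := by simp [he]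
  have hee1 : e 1 = 0 := by simp [he]
  have hr2 : 0 < r * r := mul_self_pos.2 hr
  refine ⟨Fin.cons (e + (s + r) • b) (Fin.cons (e + (s - r) • b)
    fun i => vecCons 0 (vecCons 0 (p i))), ?_, ?_, ?_⟩
  · refine linearIndependent_finCons.2 ⟨linearIndependent_finCons.2 ⟨hp.vecCons_zero.vecCons_zero,
      notMem_span_range_of_apply_ne_zero (LinearMap.proj 0) (by simp) (by simp [hee0, hb0])⟩,
      notMem_span_range_of_apply_ne_zero
        (((s - r) * b 1) • LinearMap.proj 0 - LinearMap.proj 1) ?_ ?_⟩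
    · intro i
      cases i using Fin.cases <;> simp [hee0, hee1, hb0]
    · have : (s - r) * b 1 - (s + r) * b 1 = -2 * (r * b 1) := by ring
      simp [hee0, hee1, hb0, this, hr, hb1]
  · have huw : M 0 0 + ((s + r) + (s - r)) * r = 0 := by linarith
    have hwu : M 0 0 + ((s - r) + (s + r)) * r = 0 := by linarith
    intro i j hij
    cases i using Fin.cases with
    | zero =>
      cases j using Fin.cases with
      | zero => exact absurd rfl hij
      | succ j =>
        cases j using Fin.cases with
        | zero => exact (hcomb _ _).trans huw
        | succ j => rw [hM.dotProduct_mulVec_comm]; exact hcomb0 _ _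
    | succ i =>
      cases i using Fin.cases with
      | zero =>
        cases j using Fin.cases with
        | zero => exact (hcomb _ _).trans hwu
        | succ j =>
          cases j using Fin.cases with
          | zero => exact absurd rfl hij
          | succ j => rw [hM.dotProduct_mulVec_comm]; exact hcomb0 _ _
      | succ i =>
        cases j using Fin.cases with
        | zero => exact hcomb0 _ _
        | succ j =>
          cases j using Fin.cases with
          | zero => exact hcomb0 _ _
          | succ j =>
            simp only [Fin.cons_succ, vecCons_zero_dotProduct_mulVec]
            exact ho _ _ fun h => hij (h ▸ rfl)
  · have hu : ¬ (M 0 0 + ((s + r) + (s + r)) * r < 0) := by linarith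
    have hw : M 0 0 + ((s - r) + (s - r)) * r < 0 := by linarith
    rw [Fin.card_filter_univ_succ]
    simp only [Fin.cons_zero, Fin.cons_succ, hcomb, if_neg hu]
    rw [Fin.card_filter_univ_succ]
    simp only [Fin.cons_zero, Fin.cons_succ, hcomb, if_pos hw,
      vecCons_zero_dotProduct_mulVec]
    exact add_comm _ _

/-- The symmetric tridiagonal matrix with diagonal `c` and off-diagonal entries `1`. -/
def tridiag (m : ℕ) (c : ℕ → ℝ) : Matrix (Fin m) (Fin m) ℝ :=
  Matrix.of fun i j =>
    if (i : ℕ) = (j : ℕ) then c i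
    else if (i : ℕ) + 1 = (j : ℕ) ∨ (j : ℕ) + 1 = (i : ℕ) then 1 else 0

theorem tridiag_isSymm (m : ℕ) (c : ℕ → ℝ) : (tridiag m c).IsSymm := by
  ext i j
  simp only [tridiag, transpose_apply, of_apply]
  grind

theorem tridiag_submatrix_succ (m : ℕ) (c : ℕ → ℝ) :
    (tridiag (m + 1) c).submatrix Fin.succ Fin.succ = tridiag m fun i => c (i + 1) := by
  ext i j
  simp [tridiag]

theorem tridiag_mulVec {m : ℕ} (c : ℕ → ℝ) {x : ℕ → ℝ} (hx : x m = 0) (i : Fin m) :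
    (tridiag m c *ᵥ fun j => x j) i
      = (if (i : ℕ) = 0 then 0 else x (i - 1)) + c i * x i + x (i + 1) := by
  have hsum : (tridiag m c *ᵥ fun j => x j) i = ∑ j ∈ Finset.range m,
      ((if (i : ℕ) = j then c i * x j else 0) + (if (i : ℕ) + 1 = j then x j else 0)
        + if (i : ℕ) - 1 = j then (if (i : ℕ) = 0 then 0 else x j) else 0) := by
    rw [Finset.sum_range, mulVec, dotProduct]
    refine Finset.sum_congr rfl fun j _ => ?_
    simp only [tridiag, of_apply]
    grind
  have hi := i.isLt
  rw [hsum, Finset.sum_add_distrib, Finset.sum_add_distrib, Finset.sum_ite_eq, Finset.sum_ite_eq,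
    Finset.sum_ite_eq]
  simp only [Finset.mem_range]
  grind

theorem signVar_zero_cons (l : List ℝ) : signVar (0 :: l) = signVar l := by
  simp [signVar]

theorem signVar_cons_cons {a b : ℝ} (hb : b ≠ 0) (l : List ℝ) :
    signVar (a :: b :: l) = (if a * b < 0 then 1 else 0) + signVar (b :: l) := by
  by_cases ha : a = 0
  · simp [ha, signVar_zero_cons]
  · simp [signVar, ha, hb, signChanges]

theorem signVar_cons_zero_cons (a : ℝ) (l : List ℝ) :
    signVar (a :: 0 :: l) = signVar (a :: l) := by
  by_cases ha : a = 0 <;> simp [signVar, ha]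

theorem hasOrthogonalFamily_tridiag (m : ℕ) : ∀ (c v : ℕ → ℝ),
    (∀ i < m, v i = c i * v (i + 1) - v (i + 2)) → v m ≠ 0 → v (m + 1) = 0 →
    HasOrthogonalFamily (tridiag m c) (signVar (List.ofFn fun i : Fin (m + 1) => v i)) := by
  induction m using Nat.strong_induction_on with
  | _ m ih =>
  intro c v hrec hv hv'
  cases m with
  | zero =>
    refine ⟨fun i => i.elim0, linearIndependent_empty_type, fun i => i.elim0, ?_⟩
    by_cases h : v 0 = 0 <;> simp [signVar, signChanges, h]
  | succ m =>
  have hMb : tridiag (m + 1) c *ᵥ (fun j => (-1) ^ (j : ℕ) * v (j + 1)) = vecCons (v 0) 0 := by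
    ext i
    rw [tridiag_mulVec c (x := fun j => (-1) ^ j * v (j + 1)) (by simp [hv'])]
    have h := hrec i i.isLt
    cases i using Fin.cases with
    | zero => simp at h ⊢; linarith
    | succ i =>
      simp only [Fin.val_succ, cons_val_succ, Pi.zero_apply] at h ⊢
      simp only [Nat.add_eq_zero_iff, one_ne_zero, and_false, if_false, Nat.add_sub_cancel, h,
        pow_succ]
      ring
  by_cases h1 : v 1 = 0
  · cases m with
    | zero => exact absurd h1 hv
    | succ m =>
    have h2 : v 2 ≠ 0 := by
      intro h2
      have : ∀ j ≤ m, v (j + 1) = 0 ∧ v (j + 2) = 0 := by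
        intro j
        induction j with
        | zero => exact fun _ => ⟨h1, h2⟩
        | succ j ihj =>
          intro hj
          obtain ⟨ha, hb⟩ := ihj (by omega)
          have := hrec (j + 1) (by omega)
          refine ⟨hb, ?_⟩
          rw [ha, hb] at this
          simpa using this.symm
      exact hv (this m le_rfl).2
    have h0 : v 0 = -v 2 := by simpa [h1] using hrec 0 (by omega)
    have key := ih m (by omega) (fun i => c (i + 1 + 1)) (fun i => v (i + 2))
      (fun i hi => hrec (i + 2) (by omega)) hv hv'
    rw [← tridiag_submatrix_succ m fun i => c (i + 1), ← tridiag_submatrix_succ] at key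
    have := key.succ_succ (tridiag_isSymm _ _) (fun i => by simp [tridiag])
      (by simp [h1]) (by simpa using h2) (by simpa [h0] using h2) hMb
    convert this using 1
    rw [List.ofFn_succ, List.ofFn_succ, List.ofFn_succ]
    simp only [Fin.val_zero, Fin.val_succ, zero_add, h1, signVar_cons_zero_cons]
    rw [signVar_cons_cons h2, List.ofFn_succ, if_pos]
    · simp
    · rw [h0]; nlinarith [mul_self_pos.2 h2]
  · have key := ih m (by omega) (fun i => c (i + 1)) (fun i => v (i + 1))
      (fun i hi => hrec (i + 1) (by omega)) hv hv'
    rw [← tridiag_submatrix_succ] at key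
    have := key.succ (tridiag_isSymm _ _) (by simpa using h1) hMb
    convert this using 1
    rw [List.ofFn_succ, List.ofFn_succ]
    simp only [Fin.val_zero, Fin.val_succ, zero_add]
    rw [signVar_cons_cons h1, List.ofFn_succ]
    simp

theorem stmt13 (f g : Polynomial ℝ)
    (hf : 0 < f.natDegree) (hg : 0 < g.natDegree)
    (m : ℕ) (hm : 1 ≤ m)
    (F d : ℕ → Polynomial ℝ)
    (hF0 : F 0 = f) (hF1 : F 1 = g)
    (hrec : ∀ i, 1 ≤ i → i < m → F (i - 1) = d i * F i - F (i + 1))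
    (hdeg : ∀ i, 1 ≤ i → i < m → (F (i + 1)).degree < (F i).degree)
    (hlast : F (m - 1) = d m * F m)
    (hFm : F m ≠ 0)
    (a : ℝ) (ha : ¬(f.eval a = 0 ∧ g.eval a = 0)) :
    negInertia (sturmMatrix m d a)
      = signVar (List.ofFn fun i : Fin (m + 1) => (F (i : ℕ)).eval a) := by
  obtain ⟨n, rfl⟩ : ∃ n, m = n + 1 := ⟨m - 1, by omega⟩
  set v : ℕ → ℝ := fun i => if i ≤ n + 1 then (F i).eval a else 0 with hv
  have hvF : ∀ i ≤ n + 1, v i = (F i).eval a := fun i hi => if_pos hi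
  have hlast0 : v (n + 2) = 0 := if_neg (by omega)
  have hrecv : ∀ i < n + 1, v i = (d (i + 1)).eval a * v (i + 1) - v (i + 2) := by
    intro i hi
    rcases Nat.lt_succ_iff_lt_or_eq.1 hi with h | rfl
    · rw [hvF _ (by omega), hvF _ (by omega), hvF _ (by omega)]
      simpa using congrArg (Polynomial.eval a) (hrec (i + 1) (by omega) (by omega))
    · rw [hlast0, hvF _ (by omega), hvF _ le_rfl]
      simpa using congrArg (Polynomial.eval a) hlast
  have hvm : v (n + 1) ≠ 0 := by
    intro h
    have hzero : ∀ j ≤ n + 1, v (n + 1 - j) = 0 ∧ v (n + 1 - j + 1) = 0 := by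
      intro j
      induction j with
      | zero => exact fun _ => ⟨h, hlast0⟩
      | succ j ih =>
        intro hj
        obtain ⟨h1, h2⟩ := ih (by omega)
        obtain ⟨t, ht⟩ : ∃ t, n + 1 - j = t + 1 := ⟨n - j, by omega⟩
        have ht' : n + 1 - (j + 1) = t := by omega
        rw [ht] at h1 h2
        rw [ht']
        exact ⟨by rw [hrecv t (by omega), h1, h2]; simp, h1⟩
    obtain ⟨h0, h1⟩ := hzero (n + 1) le_rfl
    simp only [Nat.sub_self, zero_add] at h0 h1
    rw [hvF _ (by omega)] at h0 h1
    exact ha ⟨hF0 ▸ h0, hF1 ▸ h1⟩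
  have key := hasOrthogonalFamily_tridiag (n + 1) (fun i => (d (i + 1)).eval a) v hrecv hvm hlast0
  have hS : sturmMatrix (n + 1) d a = tridiag (n + 1) fun i => (d (i + 1)).eval a := rfl
  rw [hS, key.negInertia_eq (tridiag_isSymm _ _)]
  congr 2
  ext i
  exact hvF i (by omega)
end

section
/- Let (f, g) be non-constant real polynomials with Sturm matrix S_{f,g}(x), and let a₁ < … < a_k be all real roots of f̃₀ = f/gcd(f,g). Then x ↦ q(S_{f,g}(x)) is constant on each open interval (a_i, a_{i+1}) (with a₀ = −∞, a_{k+1} = +∞), where q denotes the negative index of inertia. -/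
open Polynomial Matrix

open Filter Topology QuadraticMap

/-- The diagonalization of a real symmetric matrix by an orthogonal matrix of eigenvectors, as an
equivalence of quadratic forms. -/
theorem Matrix.IsHermitian.equivalent_weightedSumSquares_eigenvalues_s14 {n : ℕ}
    {A : Matrix (Fin n) (Fin n) ℝ} (hA : A.IsHermitian) :
    A.toQuadraticForm'.Equivalent (weightedSumSquares ℝ hA.eigenvalues) := by
  set U : Matrix (Fin n) (Fin n) ℝ := hA.eigenvectorUnitary.1
  have h₁ : star U * U = 1 := Unitary.coe_star_mul_self _
  have h₂ : U * star U = 1 := Unitary.coe_mul_star_self _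
  have hAU : A = U * diagonal hA.eigenvalues * star U := by
    have h := hA.spectral_theorem
    rw [Unitary.conjStarAlgAut_apply] at h
    exact h
  refine ⟨⟨Matrix.toLin'OfInv h₂ h₁, fun v => ?_⟩⟩
  have hv : A.toQuadraticForm' v = v ⬝ᵥ A *ᵥ v := by
    simp [Matrix.toQuadraticForm', Matrix.toLinearMap₂'_apply']
  have hT : v ᵥ* U = star U *ᵥ v := by
    rw [star_eq_conjTranspose, conjTranspose_eq_transpose_of_trivial, mulVec_transpose]
  have hw : v ⬝ᵥ A *ᵥ v = (star U *ᵥ v) ⬝ᵥ diagonal hA.eigenvalues *ᵥ (star U *ᵥ v) := by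
    conv_lhs => rw [hAU]
    rw [← mulVec_mulVec, ← mulVec_mulVec, dotProduct_mulVec, hT]
  rw [hv, hw, weightedSumSquares_apply]
  simp only [dotProduct, mulVec_diagonal, smul_eq_mul]
  refine Finset.sum_congr rfl fun i _ => ?_
  change hA.eigenvalues i * ((star U *ᵥ v) i * (star U *ᵥ v) i) = _
  ring

theorem sigNeg_toQuadraticForm' {n : ℕ} {A : Matrix (Fin n) (Fin n) ℝ} (hA : A.IsHermitian) :
    sigNeg A.toQuadraticForm' = negInertia A := by
  rw [QuadraticForm.sigNeg_of_equiv_weightedSumSquares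
    hA.equivalent_weightedSumSquares_eigenvalues_s14, negInertia, dif_pos hA,
    ← Set.ncard_coe_finset]
  simp

theorem sigPos_add_sigNeg_toQuadraticForm' {n : ℕ} {A : Matrix (Fin n) (Fin n) ℝ}
    (hA : A.IsHermitian) (hdet : A.det ≠ 0) :
    sigPos A.toQuadraticForm' + sigNeg A.toQuadraticForm' = n := by
  have hne : ∀ i, hA.eigenvalues i ≠ 0 := by
    rw [hA.det_eq_prod_eigenvalues] at hdet
    simpa [Finset.prod_ne_zero_iff] using hdet
  rw [QuadraticForm.sigPos_of_equiv_weightedSumSquares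
    hA.equivalent_weightedSumSquares_eigenvalues_s14,
    QuadraticForm.sigNeg_of_equiv_weightedSumSquares
    hA.equivalent_weightedSumSquares_eigenvalues_s14, ← Set.ncard_union_eq]
  · have : {i | 0 < hA.eigenvalues i} ∪ {i | hA.eigenvalues i < 0} = Set.univ := by
      ext i
      simpa [eq_comm] using (hne i).symm.lt_or_gt
    simp [this, Set.ncard_univ]
  · exact Set.disjoint_left.2 fun i hi hi' =>
      lt_asymm (Set.mem_ofPred.1 hi) (Set.mem_ofPred.1 hi')

/-- The positive index of inertia of a continuous family of quadratic forms is lower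
semicontinuous. -/
theorem eventually_sigPos_le {X E : Type*} [TopologicalSpace X] [NormedAddCommGroup E]
    [NormedSpace ℝ E] [FiniteDimensional ℝ E] {Q : X → QuadraticForm ℝ E}
    (hQ : Continuous fun p : X × E => Q p.1 p.2) (x₀ : X) :
    ∀ᶠ x in 𝓝 x₀, sigPos (Q x₀) ≤ sigPos (Q x) := by
  obtain ⟨V, hV, hpos⟩ := exists_finrank_eq_sigPos_and_posDef (Q x₀)
  have hK : IsCompact (Metric.sphere (0 : V) 1) := isCompact_sphere 0 1
  have hQV : Continuous fun p : X × V => Q p.1 p.2 :=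
    hQ.comp (continuous_fst.prodMk (continuous_subtype_val.comp continuous_snd))
  have key : ∀ᶠ x in 𝓝 x₀, ∀ v ∈ Metric.sphere (0 : V) 1, 0 < Q x v :=
    hK.eventually_forall_of_forall_eventually fun v hv =>
      hQV.continuousAt.eventually_const_lt (hpos v (ne_zero_of_mem_unit_sphere ⟨v, hv⟩))
  filter_upwards [key] with x hx
  rw [← hV]
  refine le_sigPos_of_posDef (Q x) (V := V) fun v hv => ?_
  have hnorm : ‖v‖ ≠ 0 := norm_ne_zero_iff.2 hv
  have h := hx (‖v‖⁻¹ • v) (by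
    rw [mem_sphere_zero_iff_norm, norm_smul, norm_inv, norm_norm, inv_mul_cancel₀ hnorm])
  rw [Submodule.coe_smul, QuadraticMap.map_smul, smul_eq_mul] at h
  exact pos_of_mul_pos_right h (mul_self_nonneg _)

/-- The negative index of inertia of a continuous family of symmetric matrices is constant on
preconnected sets where the determinant does not vanish. -/
theorem IsPreconnected.negInertia_eq {X : Type*} [TopologicalSpace X] {n : ℕ}
    {M : X → Matrix (Fin n) (Fin n) ℝ} (hM : Continuous M) (hsymm : ∀ x, (M x).IsHermitian)
    {s : Set X} (hs : IsPreconnected s) (hdet : ∀ x ∈ s, (M x).det ≠ 0) {x y : X} (hx : x ∈ s)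
    (hy : y ∈ s) : negInertia (M x) = negInertia (M y) := by
  have hQ : Continuous fun p : X × (Fin n → ℝ) => (M p.1).toQuadraticForm' p.2 := by
    have : ∀ p : X × (Fin n → ℝ), (M p.1).toQuadraticForm' p.2 = p.2 ⬝ᵥ M p.1 *ᵥ p.2 := by
      simp [Matrix.toQuadraticForm', Matrix.toLinearMap₂'_apply']
    simp only [this]
    fun_prop
  have hQ' : Continuous fun p : X × (Fin n → ℝ) => (-(M p.1).toQuadraticForm') p.2 :=
    hQ.neg
  refine hs.constant (f := fun x => negInertia (M x)) (fun x₀ hx₀ => ?_) hx hy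
  rw [ContinuousWithinAt, nhds_discrete, tendsto_pure]
  have hpos := eventually_sigPos_le (Q := fun x => (M x).toQuadraticForm') hQ x₀
  have hneg := eventually_sigPos_le (Q := fun x => -(M x).toQuadraticForm') hQ' x₀
  filter_upwards [self_mem_nhdsWithin, nhdsWithin_le_nhds hpos, nhdsWithin_le_nhds hneg]
    with z hz hp hn
  rw [sigPos_neg, sigPos_neg] at hn
  have h₀ := sigPos_add_sigNeg_toQuadraticForm' (hsymm x₀) (hdet x₀ hx₀)
  have h₁ := sigPos_add_sigNeg_toQuadraticForm' (hsymm z) (hdet z hz)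
  rw [← sigNeg_toQuadraticForm' (hsymm x₀), ← sigNeg_toQuadraticForm' (hsymm z)]
  lia

theorem isHermitian_sturmMatrix (m : ℕ) (d : ℕ → ℝ[X]) (x : ℝ) :
    (sturmMatrix m d x).IsHermitian := by
  refine Matrix.IsHermitian.ext fun i j => ?_
  by_cases h : (i : ℕ) = j
  · simp [sturmMatrix, h]
  · simp [sturmMatrix, h, Ne.symm h, or_comm]

theorem continuous_sturmMatrix (m : ℕ) (d : ℕ → ℝ[X]) : Continuous (sturmMatrix m d) := by
  refine continuous_pi fun i => continuous_pi fun j => ?_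
  simp only [sturmMatrix, of_apply]
  split_ifs
  · exact (d _).continuous
  · exact continuous_const
  · exact continuous_const

/-- The three-term recursion for the determinant of a Sturm matrix. -/
theorem det_sturmMatrix_add_two (n : ℕ) (d : ℕ → ℝ[X]) (x : ℝ) :
    (sturmMatrix (n + 2) d x).det =
      (d 1).eval x * (sturmMatrix (n + 1) (fun i => d (i + 1)) x).det -
        (sturmMatrix n (fun i => d (i + 2)) x).det := by
  have h₁ : (sturmMatrix (n + 2) d x).submatrix Fin.succ (Fin.succAbove 0) =
      sturmMatrix (n + 1) (fun i => d (i + 1)) x := by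
    ext i j
    simp [sturmMatrix]
  have h₂ : ((sturmMatrix (n + 2) d x).submatrix Fin.succ (Fin.succAbove 1)).det =
      (sturmMatrix n (fun i => d (i + 2)) x).det := by
    rw [det_succ_column_zero, Fin.sum_univ_succ, Finset.sum_eq_zero]
    · have : ((sturmMatrix (n + 2) d x).submatrix Fin.succ (Fin.succAbove 1)).submatrix
          (Fin.succAbove 0) Fin.succ = sturmMatrix n (fun i => d (i + 2)) x := by
        ext i j
        simp [sturmMatrix]
      rw [this]
      simp [sturmMatrix]
    · intro i _
      simp [sturmMatrix]
  rw [det_succ_row_zero, Fin.sum_univ_succ, Fin.sum_univ_succ, Finset.sum_eq_zero]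
  · rw [h₁, Fin.succ_zero_eq_one, h₂]
    simp [sturmMatrix]
    ring
  · intro i _
    simp [sturmMatrix]

/-- For a Sturm chain, `F (m - j)` is the product of `F m` with the determinant of the lower right
`j × j` block of the Sturm matrix. -/
theorem exists_eq_mul_and_det_sturmMatrix {m : ℕ} {F d : ℕ → ℝ[X]}
    (hrec : ∀ i, 1 ≤ i → i < m → F (i - 1) = d i * F i - F (i + 1))
    (hlast : F (m - 1) = d m * F m) (j : ℕ) (hj : j ≤ m) :
    ∃ P : ℝ[X], F (m - j) = P * F m ∧
      ∀ x, (sturmMatrix j (fun i => d (i + (m - j))) x).det = P.eval x := by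
  induction j using Nat.twoStepInduction with
  | zero => exact ⟨1, by simp, by simp⟩
  | one =>
    refine ⟨d m, hlast, fun x => ?_⟩
    simp [sturmMatrix, Nat.add_sub_cancel' hj]
  | more j ih₀ ih₁ =>
    obtain ⟨P, hP, hPdet⟩ := ih₀ (by lia)
    obtain ⟨R, hR, hRdet⟩ := ih₁ (by lia)
    obtain ⟨l, rfl⟩ : ∃ l, m = l + (j + 2) := ⟨m - (j + 2), by lia⟩
    have e₀ : l + (j + 2) - j = l + 2 := by lia
    have e₁ : l + (j + 2) - (j + 1) = l + 1 := by lia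
    have e₂ : l + (j + 2) - (j + 2) = l := by lia
    rw [e₀] at hP
    rw [e₁] at hR
    simp only [e₀] at hPdet
    simp only [e₁] at hRdet
    simp only [e₂]
    refine ⟨d (l + 1) * R - P, ?_, fun x => ?_⟩
    · have h := hrec (l + 1) (by lia) (by lia)
      rw [Nat.add_sub_cancel, hR, hP] at h
      rw [h]
      ring
    · have s₁ : (fun i => d (i + 1 + l)) = fun i => d (i + (l + 1)) := by
        funext i; congr 1; lia
      have s₂ : (fun i => d (i + 2 + l)) = fun i => d (i + (l + 2)) := by
        funext i; congr 1; lia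
      rw [det_sturmMatrix_add_two, s₁, s₂, hPdet, hRdet, add_comm 1 l]
      simp

theorem stmt14 (f g : Polynomial ℝ)
    (hf : 0 < f.natDegree) (hg : 0 < g.natDegree)
    (m : ℕ) (hm : 1 ≤ m)
    (F d : ℕ → Polynomial ℝ)
    (hF0 : F 0 = f) (hF1 : F 1 = g)
    (hrec : ∀ i, 1 ≤ i → i < m → F (i - 1) = d i * F i - F (i + 1))
    (hdeg : ∀ i, 1 ≤ i → i < m → (F (i + 1)).degree < (F i).degree)
    (hlast : F (m - 1) = d m * F m)
    (hFm : F m ≠ 0)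
    -- a₁ < … < a_k are all the real roots of f̃₀ = f / gcd(f, g) = f / F m:
    (k : ℕ) (a : Fin k → ℝ) (hmono : StrictMono a)
    (hroots : ∀ x : ℝ, (f / F m).eval x = 0 ↔ ∃ i, a i = x) :
    -- q(S_{f,g}(·)) is constant on each open interval between consecutive roots
    -- (including the unbounded intervals):
    ∀ x y : ℝ, x ≤ y → (∀ i, a i < x ∨ y < a i) →
      negInertia (sturmMatrix m d x) = negInertia (sturmMatrix m d y) := by
  intro x y hxy hroot
  obtain ⟨P, hP, hPdet⟩ := exists_eq_mul_and_det_sturmMatrix hrec hlast m le_rfl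
  simp only [Nat.sub_self, add_zero] at hP hPdet
  have hquot : f / F m = P := by
    rw [← hF0, hP, mul_div_cancel_right₀ _ hFm]
  refine isPreconnected_Icc.negInertia_eq (continuous_sturmMatrix m d)
    (isHermitian_sturmMatrix m d) (fun z hz hdet => ?_) (Set.left_mem_Icc.2 hxy)
    (Set.right_mem_Icc.2 hxy)
  rw [← hquot] at hPdet
  obtain ⟨i, rfl⟩ := (hroots z).1 ((hPdet z).symm.trans hdet)
  exact (hroot i).elim (fun h => h.not_ge hz.1) fun h => h.not_ge hz.2
end
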